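/- arXiv:2511.16288 — 2 statements merged into one kernel-verified Lean document; each statement's English description precedes it below -/
import Mathlib

section
/- Let (Ω, 𝔽, P) be a probability space and H : Ω → ℝ^d a random vector with ‖H‖₂ ≤ B almost surely. Let U and Û be d×k real matrices with orthonormal columns, let Q be the orthogonal polar factor of UᵀÛ, and let a ∈ ℝ^k be a unit vector. Define the population score S := (Q a)ᵀ Uᵀ H and the plug-in score Ŝ := aᵀ Ûᵀ H, and suppose S satisfies the Tsybakov margin condition: P(|S| ≤ t) ≤ C·t^κ for all t > 0, for some C, κ > 0. Then P(sign(Ŝ) ≠ sign(S)) ≤ C · (√2 · B · ‖(I_d − U Uᵀ) Û‖)^κ. -/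
open Matrix MeasureTheory

/-- The ℓ²→ℓ² operator norm of a real matrix. -/
noncomputable def opNorm {m n : ℕ} (M : Matrix (Fin m) (Fin n) ℝ) : ℝ :=
  ‖LinearMap.toContinuousLinearMap (Matrix.toEuclideanLin M)‖

/-- The Euclidean (ℓ²) norm of a vector. -/
noncomputable def euclNorm {n : ℕ} (x : Fin n → ℝ) : ℝ := Real.sqrt (∑ i, x i ^ 2)

theorem aux_dot_eq {m n : ℕ} (M N : Matrix (Fin m) (Fin n) ℝ) (x y : Fin n → ℝ) :
    (M *ᵥ x) ⬝ᵥ (N *ᵥ y) = x ⬝ᵥ ((Mᵀ * N) *ᵥ y) := by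
  rw [← Matrix.mulVec_mulVec, Matrix.dotProduct_mulVec x, Matrix.vecMul_transpose]

theorem aux_opNorm {m n : ℕ} (M : Matrix (Fin m) (Fin n) ℝ) (x : Fin n → ℝ) :
    (M *ᵥ x) ⬝ᵥ (M *ᵥ x) ≤ opNorm M ^ 2 * (x ⬝ᵥ x) := by
  have h := (LinearMap.toContinuousLinearMap (Matrix.toEuclideanLin M)).le_opNorm (WithLp.toLp 2 x)
  have h2 := pow_le_pow_left₀ (norm_nonneg _) h 2
  rw [mul_pow, EuclideanSpace.norm_sq_eq, EuclideanSpace.norm_sq_eq] at h2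
  simpa [dotProduct, opNorm, ← pow_two, Matrix.toLpLin_toLp] using h2

theorem aux_cs {n : ℕ} (x y : Fin n → ℝ) : (x ⬝ᵥ y) ^ 2 ≤ (x ⬝ᵥ x) * (y ⬝ᵥ y) := by
  have := Finset.sum_mul_sq_le_sq_mul_sq Finset.univ x y
  simpa [dotProduct, ← pow_two] using this

theorem aux_sub_sq {n : ℕ} (x y : Fin n → ℝ) :
    (x - y) ⬝ᵥ (x - y) = x ⬝ᵥ x - 2 * (x ⬝ᵥ y) + y ⬝ᵥ y := by
  rw [sub_dotProduct, dotProduct_sub, dotProduct_sub, dotProduct_comm y x]; ring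

theorem aux_self_nonneg {n : ℕ} (x : Fin n → ℝ) : 0 ≤ x ⬝ᵥ x :=
  Finset.sum_nonneg fun i _ => mul_self_nonneg (x i)

theorem aux_main {d k : ℕ} (U Uhat : Matrix (Fin d) (Fin k) ℝ)
    (hU : Uᵀ * U = 1) (hUhat : Uhatᵀ * Uhat = 1)
    (Q R : Matrix (Fin k) (Fin k) ℝ)
    (hQ : Qᵀ * Q = 1) (hR : R.PosSemidef) (hpolar : Uᵀ * Uhat = Q * R)
    (a : Fin k → ℝ) :
    (Uhat *ᵥ a - U *ᵥ (Q *ᵥ a)) ⬝ᵥ (Uhat *ᵥ a - U *ᵥ (Q *ᵥ a)) ≤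
      2 * opNorm ((1 - U * Uᵀ) * Uhat) ^ 2 * (a ⬝ᵥ a) := by
  have isoU : ∀ x y : Fin k → ℝ, (U *ᵥ x) ⬝ᵥ (U *ᵥ y) = x ⬝ᵥ y := fun x y => by
    rw [aux_dot_eq, hU, one_mulVec]
  have isoV : ∀ x y : Fin k → ℝ, (Uhat *ᵥ x) ⬝ᵥ (Uhat *ᵥ y) = x ⬝ᵥ y := fun x y => by
    rw [aux_dot_eq, hUhat, one_mulVec]
  have isoQ : ∀ x y : Fin k → ℝ, (Q *ᵥ x) ⬝ᵥ (Q *ᵥ y) = x ⬝ᵥ y := fun x y => by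
    rw [aux_dot_eq, hQ, one_mulVec]
  have cross : ∀ x y : Fin k → ℝ, (Uhat *ᵥ x) ⬝ᵥ (U *ᵥ (Q *ᵥ y)) = (R *ᵥ x) ⬝ᵥ y := fun x y => by
    rw [dotProduct_comm, aux_dot_eq, hpolar, ← mulVec_mulVec, isoQ, dotProduct_comm]
  have hproj : ∀ x : Fin k → ℝ, ((1 - U * Uᵀ) * Uhat) *ᵥ x
      = Uhat *ᵥ x - U *ᵥ (Q *ᵥ (R *ᵥ x)) := fun x => by
    rw [Matrix.sub_mul, Matrix.one_mul, sub_mulVec, Matrix.mul_assoc, hpolar]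
    simp only [← mulVec_mulVec]
  have hp2 : ∀ x : Fin k → ℝ, (((1 - U * Uᵀ) * Uhat) *ᵥ x) ⬝ᵥ (((1 - U * Uᵀ) * Uhat) *ᵥ x)
      = x ⬝ᵥ x - (R *ᵥ x) ⬝ᵥ (R *ᵥ x) := fun x => by
    rw [hproj, aux_sub_sq, isoV, cross, isoU, isoQ]; ring
  have hcon : ∀ x : Fin k → ℝ, (R *ᵥ x) ⬝ᵥ (R *ᵥ x) ≤ x ⬝ᵥ x := fun x => by
    have := aux_self_nonneg (((1 - U * Uᵀ) * Uhat) *ᵥ x)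
    rw [hp2] at this; linarith
  have hle : ∀ x : Fin k → ℝ, x ⬝ᵥ (R *ᵥ x) ≤ x ⬝ᵥ x := fun x => by
    have := aux_self_nonneg (x - R *ᵥ x)
    rw [aux_sub_sq] at this
    linarith [hcon x]
  have hsym : Rᵀ = R := by
    have := hR.isHermitian
    rwa [IsHermitian, conjTranspose_eq_transpose_of_trivial] at this
  have hRR : (R *ᵥ a) ⬝ᵥ (R *ᵥ a) ≤ (R *ᵥ a) ⬝ᵥ a := by
    have h := hR.dotProduct_mulVec_nonneg (a - R *ᵥ a)
    simp only [star_trivial] at h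
    rw [mulVec_sub, sub_dotProduct, dotProduct_sub, dotProduct_sub] at h
    have e : a ⬝ᵥ (R *ᵥ (R *ᵥ a)) = (R *ᵥ a) ⬝ᵥ (R *ᵥ a) := by
      rw [aux_dot_eq, hsym, mulVec_mulVec]
    rw [e, dotProduct_comm a] at h
    linarith [hle (R *ᵥ a)]
  rw [aux_sub_sq, isoV, cross, isoU, isoQ]
  have := aux_opNorm ((1 - U * Uᵀ) * Uhat) a
  rw [hp2] at this
  linarith

theorem aux_sign {x y δ : ℝ} (h : |x - y| ≤ δ) (hs : Real.sign x ≠ Real.sign y) : |y| ≤ δ := by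
  rw [abs_le] at h
  rcases lt_trichotomy y 0 with hy | hy | hy
  · have : ¬ x < 0 := fun hx => hs (by rw [Real.sign_of_neg hx, Real.sign_of_neg hy])
    rw [abs_of_neg hy]; linarith
  · subst hy; rw [abs_zero]; linarith
  · have : ¬ 0 < x := fun hx => hs (by rw [Real.sign_of_pos hx, Real.sign_of_pos hy])
    rw [abs_of_pos hy]; linarith

/-- Risk bound at the level of the principal-angle distance: if ‖H‖₂ ≤ B a.s.,
U, Û have orthonormal columns, Q is the orthogonal polar factor of UᵀÛ, a is a unit
vector, and the population score S = (Qa)ᵀUᵀH satisfies the Tsybakov margin condition,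
then the plug-in score Ŝ = aᵀÛᵀH satisfies
P(sign Ŝ ≠ sign S) ≤ C (√2 · B · ‖(I − UUᵀ)Û‖)^κ. -/
theorem stmt9 {d k : ℕ} {Ω : Type*} [MeasurableSpace Ω] (P : Measure Ω)
    [IsProbabilityMeasure P]
    (H : Ω → (Fin d → ℝ)) (B : ℝ) (hH : ∀ᵐ ω ∂P, euclNorm (H ω) ≤ B)
    (U Uhat : Matrix (Fin d) (Fin k) ℝ)
    (hU : Uᵀ * U = 1) (hUhat : Uhatᵀ * Uhat = 1)
    (Q R : Matrix (Fin k) (Fin k) ℝ)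
    (hQ : Qᵀ * Q = 1) (hR : R.PosSemidef) (hpolar : Uᵀ * Uhat = Q * R)
    (a : Fin k → ℝ) (ha : euclNorm a = 1)
    (C κ : ℝ) (hC : 0 < C) (hκ : 0 < κ)
    (hmargin : ∀ t : ℝ, 0 < t →
      P {ω | |(Q *ᵥ a) ⬝ᵥ (Uᵀ *ᵥ H ω)| ≤ t} ≤ ENNReal.ofReal (C * t ^ κ)) :
    P {ω | Real.sign (a ⬝ᵥ (Uhatᵀ *ᵥ H ω)) ≠ Real.sign ((Q *ᵥ a) ⬝ᵥ (Uᵀ *ᵥ H ω))} ≤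
      ENNReal.ofReal (C * (Real.sqrt 2 * B * opNorm ((1 - U * Uᵀ) * Uhat)) ^ κ) := by
  have hN : 0 ≤ opNorm ((1 - U * Uᵀ) * Uhat) := norm_nonneg _
  have hB : 0 ≤ B := by
    obtain ⟨ω, hω⟩ := hH.exists
    exact (Real.sqrt_nonneg _).trans hω
  have ha1 : a ⬝ᵥ a = 1 := by
    have := Real.sqrt_eq_one.mp ha
    simpa [dotProduct, ← pow_two] using this
  have hm := aux_main U Uhat hU hUhat Q R hQ hR hpolar a
  rw [ha1, mul_one] at hm
  generalize opNorm ((1 - U * Uᵀ) * Uhat) = s at *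
  have hδ : 0 ≤ Real.sqrt 2 * B * s := by positivity
  have hdiff : ∀ᵐ ω ∂P, |a ⬝ᵥ (Uhatᵀ *ᵥ H ω) - (Q *ᵥ a) ⬝ᵥ (Uᵀ *ᵥ H ω)|
      ≤ Real.sqrt 2 * B * s := by
    filter_upwards [hH] with ω hω
    have hHH : H ω ⬝ᵥ H ω ≤ B ^ 2 := by
      have := (Real.sqrt_le_left hB).mp hω
      simpa [dotProduct, ← pow_two] using this
    have e : a ⬝ᵥ (Uhatᵀ *ᵥ H ω) - (Q *ᵥ a) ⬝ᵥ (Uᵀ *ᵥ H ω)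
        = (Uhat *ᵥ a - U *ᵥ (Q *ᵥ a)) ⬝ᵥ H ω := by
      rw [sub_dotProduct, dotProduct_mulVec, dotProduct_mulVec, vecMul_transpose,
        vecMul_transpose]
    rw [e]
    apply abs_le_of_sq_le_sq _ hδ
    calc _ ≤ _ := aux_cs _ _
      _ ≤ (2 * s ^ 2) * B ^ 2 := mul_le_mul hm hHH (aux_self_nonneg _) (by positivity)
      _ = _ := by rw [mul_pow, mul_pow, Real.sq_sqrt (by norm_num)]; ring
  rcases hδ.eq_or_lt with h0 | hpos
  · have : P {ω | Real.sign (a ⬝ᵥ (Uhatᵀ *ᵥ H ω)) ≠ Real.sign ((Q *ᵥ a) ⬝ᵥ (Uᵀ *ᵥ H ω))} = 0 := by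
      have h : ∀ᵐ ω ∂P, Real.sign (a ⬝ᵥ (Uhatᵀ *ᵥ H ω))
          = Real.sign ((Q *ᵥ a) ⬝ᵥ (Uᵀ *ᵥ H ω)) := by
        filter_upwards [hdiff] with ω hω
        rw [← h0] at hω
        rw [sub_eq_zero.mp (abs_nonpos_iff.mp hω)]
      exact ae_iff.mp h
    rw [this]; exact zero_le
  · refine le_trans (measure_mono_ae ?_) (hmargin _ hpos)
    filter_upwards [hdiff] with ω hω hs
    exact aux_sign hω hs
end

section
/- Let Γ and Γ̂ be real symmetric d×d matrices with eigenvalues of Γ listed as λ₁(Γ) ≥ … ≥ λ_d(Γ), fix 1 ≤ k < d with gap := λ_k(Γ) − λ_{k+1}(Γ) > 0, and suppose Δ := ‖Γ̂ − Γ‖ < gap. Let U (resp. Û) be a d×k matrix whose columns are orthonormal eigenvectors of Γ (resp. Γ̂) for the k largest eigenvalues, and let Q be the orthogonal polar factor of UᵀÛ. Let (Ω, 𝔽, P) be a probability space, H : Ω → ℝ^d a random vector with ‖H‖₂ ≤ B almost surely, and a ∈ ℝ^k a unit vector. If the population score S := (Q a)ᵀ Uᵀ H satisfies the Tsybakov margin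 condition P(|S| ≤ t) ≤ C·t^κ for all t > 0 (with C, κ > 0), then the plug-in score Ŝ := aᵀ Ûᵀ H satisfies P(sign(Ŝ) ≠ sign(S)) ≤ C · (√2 · B · Δ / (gap − Δ))^κ. -/
open Matrix MeasureTheory

/-- The eigenvalues of a real symmetric matrix, in nonincreasing order. -/
noncomputable def eigDesc {d : ℕ} {Γ : Matrix (Fin d) (Fin d) ℝ} (hΓ : Γ.IsHermitian)
    (i : Fin d) : ℝ :=
  hΓ.eigenvalues (Tuple.sort hΓ.eigenvalues i.rev)

/-- `U` is a d×k matrix whose columns form an orthonormal set of eigenvectors of the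
symmetric matrix `Γ` associated with its `k` largest eigenvalues. -/
def IsTopEigenbasis {d k : ℕ} (hkd : k ≤ d) (Γ : Matrix (Fin d) (Fin d) ℝ)
    (U : Matrix (Fin d) (Fin k) ℝ) : Prop :=
  Uᵀ * U = 1 ∧ ∃ hΓ : Γ.IsHermitian, ∀ j : Fin k,
    Γ *ᵥ (fun i => U i j) = eigDesc hΓ (Fin.castLE hkd j) • (fun i => U i j)


lemma euclNorm_sq' {n : ℕ} (x : Fin n → ℝ) : euclNorm x ^ 2 = x ⬝ᵥ x := by
  unfold euclNorm
  rw [Real.sq_sqrt (Finset.sum_nonneg fun i _ => sq_nonneg _)]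
  simp [dotProduct, sq]

lemma euclNorm_nonneg' {n : ℕ} (x : Fin n → ℝ) : 0 ≤ euclNorm x := Real.sqrt_nonneg _

lemma euclNorm_toLp {n : ℕ} (x : Fin n → ℝ) : ‖WithLp.toLp 2 x‖ = euclNorm x := by
  simp [EuclideanSpace.norm_eq, euclNorm]

lemma cauchy' {n : ℕ} (x y : Fin n → ℝ) : |x ⬝ᵥ y| ≤ euclNorm x * euclNorm y := by
  have h := abs_real_inner_le_norm (WithLp.toLp 2 y) (WithLp.toLp 2 x)
  rw [euclNorm_toLp, euclNorm_toLp, EuclideanSpace.inner_toLp_toLp] at h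
  simpa [mul_comm] using h

lemma opNorm_nonneg' {m n : ℕ} (M : Matrix (Fin m) (Fin n) ℝ) : 0 ≤ opNorm M := norm_nonneg _

lemma opNorm_bound {m n : ℕ} (M : Matrix (Fin m) (Fin n) ℝ) (x : Fin m → ℝ) (y : Fin n → ℝ) :
    |x ⬝ᵥ (M *ᵥ y)| ≤ opNorm M * (euclNorm x * euclNorm y) := by
  have h := (LinearMap.toContinuousLinearMap (Matrix.toEuclideanLin M)).le_opNorm (WithLp.toLp 2 y)
  have h2 : (LinearMap.toContinuousLinearMap (Matrix.toEuclideanLin M)) (WithLp.toLp 2 y)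
      = WithLp.toLp 2 (M *ᵥ y) := rfl
  rw [h2, euclNorm_toLp, euclNorm_toLp] at h
  calc _ ≤ euclNorm x * euclNorm (M *ᵥ y) := cauchy' _ _
    _ ≤ euclNorm x * (opNorm M * euclNorm y) :=
        mul_le_mul_of_nonneg_left h (euclNorm_nonneg' x)
    _ = _ := by ring

lemma eigDesc_antitone {d : ℕ} {Γ : Matrix (Fin d) (Fin d) ℝ} (hΓ : Γ.IsHermitian) :
    Antitone (eigDesc hΓ) := by
  intro i j hij
  exact Tuple.monotone_sort hΓ.eigenvalues (Fin.rev_le_rev.mpr hij)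

lemma exists_eigvecs {d : ℕ} {Γ : Matrix (Fin d) (Fin d) ℝ} (hΓ : Γ.IsHermitian) :
    ∃ V : Matrix (Fin d) (Fin d) ℝ, Vᵀ * V = 1 ∧ V * Vᵀ = 1 ∧
      Γ * V = V * diagonal (eigDesc hΓ) := by
  let e : Fin d → Fin d := fun i => Tuple.sort hΓ.eigenvalues i.rev
  have he : Function.Injective e :=
    (Tuple.sort hΓ.eigenvalues).injective.comp Fin.rev_injective
  let V : Matrix (Fin d) (Fin d) ℝ := fun i j => hΓ.eigenvectorBasis (e j) i
  have h1 : Vᵀ * V = 1 := by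
    ext i j
    have h := (orthonormal_iff_ite.mp hΓ.eigenvectorBasis.orthonormal) (e i) (e j)
    rw [Matrix.mul_apply, Matrix.one_apply]
    simp only [he.eq_iff] at h
    rw [← h]
    simp [V, PiLp.inner_apply, mul_comm]
    exact Finset.sum_congr rfl fun x _ => mul_comm _ _
  refine ⟨V, h1, mul_eq_one_comm.mp h1, ?_⟩
  ext i j
  have h := congrFun (hΓ.mulVec_eigenvectorBasis (e j)) i
  rw [Matrix.mul_diagonal, Matrix.mul_apply]
  simpa [V, Matrix.mulVec, dotProduct, eigDesc, e, mul_comm] using h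

lemma quad_le {n : ℕ} {A V : Matrix (Fin n) (Fin n) ℝ} {l : Fin n → ℝ}
    (hV : V * Vᵀ = 1) (hA : A * V = V * diagonal l) (x : Fin n → ℝ) (c : ℝ)
    (h : ∀ i, (Vᵀ *ᵥ x) i ≠ 0 → l i ≤ c) : x ⬝ᵥ (A *ᵥ x) ≤ c * (x ⬝ᵥ x) := by
  set z := Vᵀ *ᵥ x with hz
  have hx : x = V *ᵥ z := by rw [hz, mulVec_mulVec, hV, one_mulVec]
  have hVV : Vᵀ * V = 1 := mul_eq_one_comm.mp hV
  have e1 : x ⬝ᵥ (A *ᵥ x) = z ⬝ᵥ (diagonal l *ᵥ z) := by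
    clear_value z
    subst hx
    rw [mulVec_mulVec, hA, ← mulVec_mulVec, dotProduct_mulVec, ← mulVec_transpose, mulVec_mulVec,
      hVV, one_mulVec]
  have e2 : x ⬝ᵥ x = z ⬝ᵥ z := by
    clear_value z
    subst hx
    rw [dotProduct_mulVec, ← mulVec_transpose, mulVec_mulVec, hVV, one_mulVec]
  rw [e1, e2]
  simp only [dotProduct, mulVec_diagonal, Finset.mul_sum]
  refine Finset.sum_le_sum fun i _ => ?_
  by_cases hi : z i = 0
  · simp [hi]
  · nlinarith [h i hi, mul_self_nonneg (z i)]

lemma top_mul {d k : ℕ} {hkd : k ≤ d} {Γ : Matrix (Fin d) (Fin d) ℝ}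
    {U : Matrix (Fin d) (Fin k) ℝ} (hΓ : Γ.IsHermitian) (hU : IsTopEigenbasis hkd Γ U) :
    Γ * U = U * diagonal (fun j => eigDesc hΓ (Fin.castLE hkd j)) := by
  obtain ⟨_, _, h⟩ := hU
  ext i j
  have := congrFun (h j) i
  rw [mul_diagonal]
  simpa [Matrix.mul_apply, mulVec, dotProduct, mul_comm] using this

lemma compl_zero {d k : ℕ} (hkd : k < d) {Γ V : Matrix (Fin d) (Fin d) ℝ}
    {U : Matrix (Fin d) (Fin k) ℝ} (hS : Γᵀ = Γ) (l : Fin d → ℝ) 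
    (hV : V * Vᵀ = 1) (hΓV : Γ * V = V * diagonal l)
    (hUU : Uᵀ * U = 1) (hΓU : Γ * U = U * diagonal (fun j => l (Fin.castLE hkd.le j)))
    (hl : ∀ i : Fin d, ∀ j : Fin k, k ≤ i.val → l i < l (Fin.castLE hkd.le j))
    (w : Fin d → ℝ) (hw : Uᵀ *ᵥ w = 0) (j : Fin k) : (Vᵀ *ᵥ w) (Fin.castLE hkd.le j) = 0 := by
  set N := Vᵀ * U with hN
  set c := Fin.castLE hkd.le
  have hinj : Function.Injective c := Fin.castLE_injective _
  have hcomm : diagonal l * N = N * diagonal (fun j => l (c j)) := by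
    have h1 : Vᵀ * Γ = diagonal l * Vᵀ := by
      have := congrArg transpose hΓV
      rwa [transpose_mul, transpose_mul, hS, diagonal_transpose] at this
    rw [hN, Matrix.mul_assoc, ← hΓU, ← Matrix.mul_assoc, ← h1, Matrix.mul_assoc]
  have hN0 : ∀ i, i ∉ Set.range c → ∀ j, N i j = 0 := by
    intro i hi j
    have hk : k ≤ i.val := by
      by_contra hlt
      exact hi ⟨⟨i.val, by omega⟩, by ext; rfl⟩
    have := congrFun (congrFun hcomm i) j
    rw [diagonal_mul, mul_diagonal] at this
    have h2 := hl i j hk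
    have h3 : N i j * (l (c j) - l i) = 0 := by linarith
    rcases mul_eq_zero.mp h3 with h | h
    · exact h
    · exact absurd h (by linarith)
  let M : Matrix (Fin k) (Fin k) ℝ := N.submatrix c id
  have hNN : Nᵀ * N = 1 := by
    rw [hN, transpose_mul, transpose_transpose, Matrix.mul_assoc, ← Matrix.mul_assoc V, hV,
      Matrix.one_mul, hUU]
  have hMM : Mᵀ * M = 1 := by
    rw [← hNN]
    ext a b
    simp only [Matrix.mul_apply]
    refine Fintype.sum_of_injective c hinj _ _ (fun i hi => ?_) (fun i => rfl)
    simp [hN0 i hi]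
  have hNz : Nᵀ *ᵥ (Vᵀ *ᵥ w) = 0 := by
    rw [hN, transpose_mul, transpose_transpose, mulVec_mulVec, Matrix.mul_assoc, hV,
      Matrix.mul_one, hw]
  have hMz : Mᵀ *ᵥ (fun j => (Vᵀ *ᵥ w) (c j)) = 0 := by
    rw [← hNz]
    ext a
    simp only [mulVec, dotProduct]
    refine Fintype.sum_of_injective c hinj _ _ (fun i hi => ?_) (fun i => rfl)
    simp [hN0 i hi]
  have h5 : (fun j => (Vᵀ *ᵥ w) (c j)) = 0 := by
    have := congrArg (fun v => M *ᵥ v) hMz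
    simpa [mulVec_mulVec, mul_eq_one_comm.mp hMM] using this
  exact congrFun h5 j

lemma dot_diag_ge {k : ℕ} (l : Fin k → ℝ) (c : ℝ) (h : ∀ i, c ≤ l i) (y : Fin k → ℝ) :
    c * (y ⬝ᵥ y) ≤ y ⬝ᵥ (diagonal l *ᵥ y) := by
  simp only [dotProduct, mulVec_diagonal, Finset.mul_sum]
  refine Finset.sum_le_sum fun i _ => ?_
  nlinarith [h i, mul_self_nonneg (y i)]

lemma isom_dot {d k : ℕ} {U : Matrix (Fin d) (Fin k) ℝ} (hU : Uᵀ * U = 1) (y z : Fin k → ℝ) :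
    (U *ᵥ y) ⬝ᵥ (U *ᵥ z) = y ⬝ᵥ z := by
  rw [dotProduct_mulVec, ← mulVec_transpose, mulVec_mulVec, hU, one_mulVec]

lemma weyl {d k : ℕ} (hk : 1 ≤ k) (hkd : k < d) (hk1 : k - 1 < d) {Γ Γhat : Matrix (Fin d) (Fin d) ℝ}
    (hΓ : Γ.IsHermitian) (hΓhat : Γhat.IsHermitian) {U : Matrix (Fin d) (Fin k) ℝ}
    (hU : IsTopEigenbasis hkd.le Γ U) :
    eigDesc hΓ ⟨k - 1, hk1⟩ - opNorm (Γhat - Γ) ≤ eigDesc hΓhat ⟨k - 1, hk1⟩ := by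
  obtain ⟨V, -, hVV, hΓV⟩ := exists_eigvecs hΓhat
  have hUU := hU.1
  have hΓU := top_mul hΓ hU
  -- a nonzero vector killed by the first k-1 coordinates
  let T : Matrix (Fin (k - 1)) (Fin k) ℝ := fun i j => (Vᵀ * U) (Fin.castLE (by omega) i) j
  obtain ⟨y, hy0, hTy⟩ : ∃ y : Fin k → ℝ, y ≠ 0 ∧ T *ᵥ y = 0 := by
    have hker := LinearMap.ker_ne_bot_of_finrank_lt (f := Matrix.toLin' T) (by simp; omega)
    obtain ⟨y, hy, hy0⟩ := Submodule.exists_mem_ne_zero_of_ne_bot hker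
    exact ⟨y, hy0, by simpa using hy⟩
  set x := U *ᵥ y with hx
  have hxx : x ⬝ᵥ x = y ⬝ᵥ y := isom_dot hUU y y
  have hpos : 0 < y ⬝ᵥ y := by
    rcases lt_or_eq_of_le (show 0 ≤ y ⬝ᵥ y from
      Finset.sum_nonneg fun i _ => mul_self_nonneg _) with h | h
    · exact h
    · exact absurd (dotProduct_self_eq_zero.mp h.symm) hy0
  have h1 : x ⬝ᵥ (Γhat *ᵥ x) ≤ eigDesc hΓhat ⟨k - 1, hk1⟩ * (x ⬝ᵥ x) := by
    refine quad_le hVV hΓV x _ fun i hi => ?_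
    apply eigDesc_antitone
    by_contra hlt
    have hlt' : i.val < k - 1 := by
      simp only [Fin.le_def, not_le] at hlt
      exact hlt
    apply hi
    have := congrFun hTy ⟨i.val, hlt'⟩
    rw [hx, mulVec_mulVec]
    exact this
  have h2 : eigDesc hΓ ⟨k - 1, hk1⟩ * (y ⬝ᵥ y) ≤ x ⬝ᵥ (Γ *ᵥ x) := by
    rw [hx, mulVec_mulVec, hΓU, ← mulVec_mulVec, isom_dot hUU]
    refine dot_diag_ge _ _ (fun i => ?_) y
    apply eigDesc_antitone
    simp [Fin.le_def]; omega
  have h3 := (abs_le.mp (opNorm_bound (Γhat - Γ) x x)).1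
  rw [← sq, euclNorm_sq', hxx, sub_mulVec, dotProduct_sub] at h3
  rw [hxx] at h1
  by_contra hlt
  push Not at hlt
  nlinarith

lemma davis_kahan {d k : ℕ} (hk : 1 ≤ k) (hkd : k < d) (hk1 : k - 1 < d) {Γ Γhat : Matrix (Fin d) (Fin d) ℝ}
    (hΓ : Γ.IsHermitian) (hΓhat : Γhat.IsHermitian) {U Uhat : Matrix (Fin d) (Fin k) ℝ}
    (hU : IsTopEigenbasis hkd.le Γ U) (hUhat : IsTopEigenbasis hkd.le Γhat Uhat) (gap Δ : ℝ)
    (hgap_def : gap = eigDesc hΓ ⟨k - 1, hk1⟩ - eigDesc hΓ ⟨k, hkd⟩)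
    (hgap_pos : 0 < gap) (hΔ_def : Δ = opNorm (Γhat - Γ)) (hΔ : Δ < gap)
    (X : Matrix (Fin d) (Fin k) ℝ) (hX : X = Uhat - U * (Uᵀ * Uhat)) (a : Fin k → ℝ) :
    a ⬝ᵥ ((Xᵀ * X) *ᵥ a) ≤ (Δ / (gap - Δ)) ^ 2 * (a ⬝ᵥ a) := by
  have hherm : (Xᵀ * X).IsHermitian := by
    simpa using Matrix.isHermitian_conjTranspose_mul_self X
  obtain ⟨W, hWW, hWW', hXW⟩ := exists_eigvecs hherm
  refine quad_le hWW' hXW a _ fun i _ => ?_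
  set μ := eigDesc hherm i with hμ
  let v : Fin k → ℝ := fun r => W r i
  have hvv : v ⬝ᵥ v = 1 := by
    have := congrFun (congrFun hWW i) i
    simpa [Matrix.mul_apply, v, dotProduct] using this
  have hXv : Xᵀ *ᵥ (X *ᵥ v) = μ • v := by
    rw [mulVec_mulVec]
    ext r
    have := congrFun (congrFun hXW r) i
    rw [mul_diagonal, Matrix.mul_apply] at this
    simpa [mulVec, dotProduct, v, mul_comm μ] using this
  set w := X *ᵥ v with hw
  have hww : w ⬝ᵥ w = μ := by
    conv_lhs => rw [hw, dotProduct_mulVec, ← mulVec_transpose, ← hw, hXv, smul_dotProduct, hvv]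
    simp
  have hUX : Uᵀ * X = 0 := by
    rw [hX, Matrix.mul_sub, ← Matrix.mul_assoc, hU.1, Matrix.one_mul, sub_self]
  have hUw : Uᵀ *ᵥ w = 0 := by rw [hw, mulVec_mulVec, hUX, zero_mulVec]
  have hwU : ∀ z, w ⬝ᵥ (U *ᵥ z) = 0 := fun z => by
    rw [dotProduct_mulVec, ← mulVec_transpose, hUw, zero_dotProduct]
  have hUh : ∀ z, Uhat *ᵥ z = X *ᵥ z + U *ᵥ ((Uᵀ * Uhat) *ᵥ z) := fun z => by
    rw [hX, sub_mulVec, mulVec_mulVec]; simp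
  have hΓU := top_mul hΓ hU
  have hΓUh := top_mul hΓhat hUhat
  have hμ0 : 0 ≤ μ := by
    rw [← hww]; exact Finset.sum_nonneg fun i _ => mul_self_nonneg _
  have hweyl := weyl hk hkd hk1 hΓ hΓhat hU
  rw [← hΔ_def] at hweyl
  have hΔ0 : 0 ≤ Δ := hΔ_def ▸ opNorm_nonneg' _
  have h1 : μ * eigDesc hΓhat ⟨k - 1, hk1⟩ ≤ w ⬝ᵥ (Γhat *ᵥ (Uhat *ᵥ v)) := by
    rw [mulVec_mulVec, hΓUh, ← mulVec_mulVec, hUh, dotProduct_add, hwU, add_zero,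
      dotProduct_mulVec, ← mulVec_transpose, hXv, smul_dotProduct, smul_eq_mul]
    refine mul_le_mul_of_nonneg_left ?_ hμ0
    have := dot_diag_ge (fun j => eigDesc hΓhat (Fin.castLE hkd.le j))
      (eigDesc hΓhat ⟨k - 1, hk1⟩) (fun i => by
        apply eigDesc_antitone
        simp [Fin.le_def]; omega) v
    simpa [hvv] using this
  have h2 : w ⬝ᵥ (Γ *ᵥ (Uhat *ᵥ v)) ≤ eigDesc hΓ ⟨k, hkd⟩ * μ := by
    rw [hUh, mulVec_add, dotProduct_add, mulVec_mulVec _ Γ U, hΓU, ← mulVec_mulVec, hwU, add_zero,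
      ← hw, ← hww]
    obtain ⟨V, -, hVV, hΓV⟩ := exists_eigvecs hΓ
    refine quad_le hVV hΓV w _ fun i hi => ?_
    apply eigDesc_antitone
    by_contra hlt
    have hlt' : i.val < k := by simpa [Fin.le_def] using hlt
    apply hi
    refine compl_zero hkd (by simpa using hΓ.eq) (eigDesc hΓ) hVV hΓV hU.1 hΓU ?_ w hUw
      ⟨i.val, hlt'⟩
    intro i j hij
    have g1 : eigDesc hΓ i ≤ eigDesc hΓ ⟨k, hkd⟩ := eigDesc_antitone hΓ (by simpa [Fin.le_def])
    have g2 : eigDesc hΓ ⟨k - 1, hk1⟩ ≤ eigDesc hΓ (Fin.castLE hkd.le j) :=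
      eigDesc_antitone hΓ (by simp [Fin.le_def]; omega)
    linarith
  have h3 := (abs_le.mp (opNorm_bound (Γhat - Γ) w (Uhat *ᵥ v))).2
  rw [← hΔ_def, sub_mulVec, dotProduct_sub] at h3
  have n1 : euclNorm (Uhat *ᵥ v) = 1 := by
    have : euclNorm (Uhat *ᵥ v) ^ 2 = 1 := by rw [euclNorm_sq', isom_dot hUhat.1, hvv]
    nlinarith [euclNorm_nonneg' (Uhat *ᵥ v)]
  have n2 : euclNorm w ^ 2 = μ := by rw [euclNorm_sq', hww]
  rw [n1, mul_one] at h3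
  have hg : 0 < gap - Δ := by linarith
  have n0 := euclNorm_nonneg' w
  have h4 : μ * (gap - Δ) ≤ Δ * euclNorm w := by nlinarith
  rw [← n2]
  refine pow_le_pow_left₀ n0 ?_ 2
  rw [le_div_iff₀ hg]
  rcases n0.eq_or_lt with h0 | h0
  · rw [← h0]; simpa using hΔ0
  · rw [← n2] at h4
    by_contra hlt
    push Not at hlt
    nlinarith

lemma pert_bound {d k : ℕ} {U Uhat X : Matrix (Fin d) (Fin k) ℝ} (hU : Uᵀ * U = 1)
    (hUhat : Uhatᵀ * Uhat = 1) {Q R : Matrix (Fin k) (Fin k) ℝ}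
    (hQ : Qᵀ * Q = 1) (hR : R.PosSemidef) (hpolar : Uᵀ * Uhat = Q * R)
    (hX : X = Uhat - U * (Uᵀ * Uhat)) (a : Fin k → ℝ) :
    (Uhat *ᵥ a - U *ᵥ (Q *ᵥ a)) ⬝ᵥ (Uhat *ᵥ a - U *ᵥ (Q *ᵥ a))
      ≤ 2 * (a ⬝ᵥ ((Xᵀ * X) *ᵥ a)) := by
  have hRT : Rᵀ = R := by simpa using hR.1.eq
  have hpolar' : Uhatᵀ * U = R * Qᵀ := by
    have := congrArg transpose hpolar
    rwa [transpose_mul, transpose_mul, transpose_transpose, hRT] at this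
  have hXX : Xᵀ * X = 1 - R * R := by
    have e1 : Uhatᵀ * (U * (Q * R)) = R * R := by
      rw [← Matrix.mul_assoc, hpolar', Matrix.mul_assoc, ← Matrix.mul_assoc Qᵀ, hQ, Matrix.one_mul]
    have e2 : (U * (Q * R))ᵀ * X = 0 := by
      rw [transpose_mul, Matrix.mul_assoc, hX, Matrix.mul_sub, ← Matrix.mul_assoc Uᵀ U, hU,
        Matrix.one_mul, sub_self, Matrix.mul_zero]
    have e3 : Xᵀ = Uhatᵀ - (U * (Q * R))ᵀ := by rw [hX, hpolar, transpose_sub]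
    rw [e3, Matrix.sub_mul, e2, sub_zero, hX, hpolar, Matrix.mul_sub, hUhat, e1]
  obtain ⟨V, hV, hV', hRV⟩ := exists_eigvecs hR.1
  set l := eigDesc hR.1
  have hl : ∀ i, l i * l i - l i ≤ 0 := by
    intro i
    let v : Fin k → ℝ := fun r => V r i
    have hvv : v ⬝ᵥ v = 1 := by
      have := congrFun (congrFun hV i) i
      simpa [Matrix.mul_apply, v, dotProduct] using this
    have hRv : R *ᵥ v = l i • v := by
      ext r
      have := congrFun (congrFun hRV r) i
      rw [mul_diagonal, Matrix.mul_apply] at this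
      simpa [mulVec, dotProduct, v, mul_comm (l i)] using this
    have p1 : 0 ≤ l i := by
      have := hR.dotProduct_mulVec_nonneg v
      simpa [hRv, hvv] using this
    have p2 : 0 ≤ v ⬝ᵥ ((Xᵀ * X) *ᵥ v) := by
      rw [← mulVec_mulVec, dotProduct_mulVec, ← mulVec_transpose, transpose_transpose]
      exact Finset.sum_nonneg fun i _ => mul_self_nonneg _
    rw [hXX, sub_mulVec, ← mulVec_mulVec, hRv, mulVec_smul, hRv, one_mulVec, dotProduct_sub,
      dotProduct_smul, dotProduct_smul, hvv] at p2
    simp only [smul_eq_mul, mul_one] at p2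
    nlinarith
  have hRR : a ⬝ᵥ ((R * R - R) *ᵥ a) ≤ 0 * (a ⬝ᵥ a) := by
    refine quad_le (l := fun i => l i * l i - l i) hV' ?_ a 0 fun i _ => hl i
    rw [Matrix.sub_mul, Matrix.mul_assoc, hRV, ← Matrix.mul_assoc, hRV, Matrix.mul_assoc,
      diagonal_mul_diagonal, ← Matrix.mul_sub, diagonal_sub]
  have c1 : (U *ᵥ (Q *ᵥ a)) ⬝ᵥ (Uhat *ᵥ a) = a ⬝ᵥ (R *ᵥ a) := by
    rw [dotProduct_comm, dotProduct_mulVec, ← mulVec_transpose, mulVec_mulVec, hpolar,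
      dotProduct_mulVec, ← mulVec_transpose, mulVec_mulVec, ← Matrix.mul_assoc, hQ,
      Matrix.one_mul, dotProduct_comm]
  rw [hXX, dotProduct_sub, sub_dotProduct, sub_dotProduct, isom_dot hUhat, isom_dot hU,
    isom_dot hQ, c1, dotProduct_comm (Uhat *ᵥ a), c1, sub_mulVec, one_mulVec, dotProduct_sub]
  rw [sub_mulVec, dotProduct_sub] at hRR
  linarith

lemma sign_ne_imp {s t : ℝ} (h : Real.sign s ≠ Real.sign t) : |t| ≤ |s - t| := by
  rcases lt_trichotomy t 0 with ht | ht | ht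
  · rcases lt_or_ge s 0 with hs | hs
    · exact absurd (by rw [Real.sign_of_neg hs, Real.sign_of_neg ht]) h
    · rw [abs_of_neg ht, abs_of_nonneg (by linarith)]; linarith
  · simp [ht]
  · rcases lt_or_ge 0 s with hs | hs
    · exact absurd (by rw [Real.sign_of_pos hs, Real.sign_of_pos ht]) h
    · rw [abs_of_pos ht, abs_of_nonpos (by linarith)]; linarith

/-- Deterministic form of the Spectral Identifiability Principle: chaining the
Davis–Kahan bound sinΘ ≤ Δ/(gap − Δ) with the coordinate-perturbation lemma and the
margin-to-risk reduction gives
P(sign Ŝ ≠ sign S) ≤ C (√2 · B · Δ/(gap − Δ))^κ. -/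
theorem stmt10 {d k : ℕ} (hk : 1 ≤ k) (hkd : k < d)
    (Γ Γhat : Matrix (Fin d) (Fin d) ℝ)
    (hΓ : Γ.IsHermitian) (hΓhat : Γhat.IsHermitian)
    (gap Δ : ℝ)
    (hgap_def : gap = eigDesc hΓ ⟨k - 1, by omega⟩ - eigDesc hΓ ⟨k, hkd⟩)
    (hgap_pos : 0 < gap)
    (hΔ_def : Δ = opNorm (Γhat - Γ))
    (hΔ : Δ < gap)
    (U Uhat : Matrix (Fin d) (Fin k) ℝ)
    (hU : IsTopEigenbasis hkd.le Γ U)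
    (hUhat : IsTopEigenbasis hkd.le Γhat Uhat)
    (Q R : Matrix (Fin k) (Fin k) ℝ)
    (hQ : Qᵀ * Q = 1) (hR : R.PosSemidef) (hpolar : Uᵀ * Uhat = Q * R)
    {Ω : Type*} [MeasurableSpace Ω] (P : Measure Ω) [IsProbabilityMeasure P]
    (H : Ω → (Fin d → ℝ)) (B : ℝ) (hH : ∀ᵐ ω ∂P, euclNorm (H ω) ≤ B)
    (a : Fin k → ℝ) (ha : euclNorm a = 1)
    (C κ : ℝ) (hC : 0 < C) (hκ : 0 < κ)
    (hmargin : ∀ t : ℝ, 0 < t →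
      P {ω | |(Q *ᵥ a) ⬝ᵥ (Uᵀ *ᵥ H ω)| ≤ t} ≤ ENNReal.ofReal (C * t ^ κ)) :
    P {ω | Real.sign (a ⬝ᵥ (Uhatᵀ *ᵥ H ω)) ≠ Real.sign ((Q *ᵥ a) ⬝ᵥ (Uᵀ *ᵥ H ω))} ≤
      ENNReal.ofReal (C * (Real.sqrt 2 * B * Δ / (gap - Δ)) ^ κ) := by
  have hg : 0 < gap - Δ := by linarith
  have hΔ0 : 0 ≤ Δ := hΔ_def ▸ opNorm_nonneg' _
  set τ := Δ / (gap - Δ) with hτ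
  have hτ0 : 0 ≤ τ := div_nonneg hΔ0 hg.le
  have haa : a ⬝ᵥ a = 1 := by rw [← euclNorm_sq', ha]; norm_num
  set D := Uhat *ᵥ a - U *ᵥ (Q *ᵥ a) with hD
  have hDK := davis_kahan hk hkd (by omega) hΓ hΓhat hU hUhat gap Δ hgap_def hgap_pos hΔ_def hΔ _ rfl a
  have hPB := pert_bound hU.1 hUhat.1 hQ hR hpolar rfl a
  rw [haa, mul_one, ← hτ] at hDK
  have hDn : euclNorm D ≤ Real.sqrt 2 * τ := by
    refine abs_le_of_sq_le_sq' ?_ (by positivity) |>.2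
    rw [euclNorm_sq', mul_pow, Real.sq_sqrt (by norm_num)]
    linarith
  have hB : 0 ≤ B := by
    obtain ⟨ω, hω⟩ := hH.exists
    exact (euclNorm_nonneg' _).trans hω
  have hT : Real.sqrt 2 * B * Δ / (gap - Δ) = Real.sqrt 2 * τ * B := by rw [hτ]; ring
  rw [hT]
  set t := Real.sqrt 2 * τ * B with ht
  have ht0 : 0 ≤ t := by positivity
  have hdiff : ∀ᵐ ω ∂P, |a ⬝ᵥ (Uhatᵀ *ᵥ H ω) - (Q *ᵥ a) ⬝ᵥ (Uᵀ *ᵥ H ω)| ≤ t := by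
    filter_upwards [hH] with ω hω
    have e : a ⬝ᵥ (Uhatᵀ *ᵥ H ω) - (Q *ᵥ a) ⬝ᵥ (Uᵀ *ᵥ H ω) = D ⬝ᵥ H ω := by
      rw [dotProduct_mulVec, dotProduct_mulVec, vecMul_transpose, vecMul_transpose, hD,
        sub_dotProduct]
    rw [e]
    exact (cauchy' _ _).trans (mul_le_mul hDn hω (euclNorm_nonneg' _) (by positivity))
  rcases ht0.eq_or_lt with h0 | hpos
  · have : P {ω | Real.sign (a ⬝ᵥ (Uhatᵀ *ᵥ H ω)) ≠
        Real.sign ((Q *ᵥ a) ⬝ᵥ (Uᵀ *ᵥ H ω))} = 0 := by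
      have h1 : ∀ᵐ ω ∂P, Real.sign (a ⬝ᵥ (Uhatᵀ *ᵥ H ω)) =
          Real.sign ((Q *ᵥ a) ⬝ᵥ (Uᵀ *ᵥ H ω)) := by
        filter_upwards [hdiff] with ω hω
        rw [← h0] at hω
        rw [sub_eq_zero.mp (abs_nonpos_iff.mp hω)]
      exact ae_iff.mp h1
    rw [this]; exact zero_le
  · refine le_trans (measure_mono_ae ?_) (hmargin t hpos)
    filter_upwards [hdiff] with ω hω hne
    exact (sign_ne_imp hne).trans hω
end
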